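/- Let $T_{q_0}$ be an initial, synchronizing, invertible transducer without states of incomplete response, with inverse $S_{(\epsilon,p_0)}$. Then the product transducers $TS$ and $ST$ are both contracting. -/

import Mathlib

open Classical

noncomputable section

/-- `n`-ary Cantor space: infinite words over the alphabet `Fin n`. -/
abbrev Cantor (n : ℕ) : Type := ℕ → Fin n

/-- The finite word `w` is a prefix of the infinite word `χ`. -/
def PrefixOf {n : ℕ} (w : List (Fin n)) (χ : Cantor n) : Prop :=
  ∀ (i : ℕ) (h : i < w.length), w.get ⟨i, h⟩ = χ i

/-- Concatenation of a finite word with an infinite word. -/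
def appendInf {n : ℕ} (w : List (Fin n)) (χ : Cantor n) : Cantor n :=
  fun i => if h : i < w.length then w.get ⟨i, h⟩ else χ (i - w.length)

/-- The cone (basic clopen set) of infinite words having the finite word `w` as prefix. -/
def cone {n : ℕ} (w : List (Fin n)) : Set (Cantor n) :=
  {χ | PrefixOf w χ}

/-- The length-`k` prefix of an infinite word, as a finite word. -/
def takeW {n : ℕ} (χ : Cantor n) (k : ℕ) : List (Fin n) :=
  List.ofFn (fun i : Fin k => χ i)

/-- A finite family of finite words forming a maximal antichain:
every infinite word has exactly one member of the family as a prefix. -/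
def AntichainFam {n m : ℕ} (α : Fin m → List (Fin n)) : Prop :=
  ∀ χ : Cantor n, ∃! i : Fin m, PrefixOf (α i) χ

/-- The group structure on self-homeomorphisms of a topological space,
with `f * g` acting as `g` followed by `f`. -/
instance homeoGroup {X : Type*} [TopologicalSpace X] : Group (X ≃ₜ X) where
  mul f g := g.trans f
  one := Homeomorph.refl X
  inv := Homeomorph.symm
  mul_assoc a b c := Homeomorph.ext fun _ => rfl
  one_mul a := Homeomorph.ext fun _ => rfl
  mul_one a := Homeomorph.ext fun _ => rfl
  inv_mul_cancel a := Homeomorph.ext fun x => a.symm_apply_apply x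

/-- The Higman–Thompson group `Vₙ`, as the set of self-homeomorphisms of Cantor space
which act by exchanging finite prefixes along a pair of maximal antichains. -/
def Vn (n : ℕ) : Set (Cantor n ≃ₜ Cantor n) :=
  {g | ∃ (m : ℕ) (α β : Fin m → List (Fin n)), AntichainFam α ∧ AntichainFam β ∧
      ∀ (i : Fin m) (χ : Cantor n), g (appendInf (α i) χ) = appendInf (β i) χ}

/-- Conjugation in the paper's right-action convention: `paperConj g v = g⁻¹ v g`,
i.e. the homeomorphism `x ↦ (x) g⁻¹ v g` (first apply `g⁻¹`, then `v`, then `g`). -/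
def paperConj {n : ℕ} (g v : Cantor n ≃ₜ Cantor n) : Cantor n ≃ₜ Cantor n :=
  (g.symm.trans v).trans g

/-- `l` is the longest common prefix of the set `A` of infinite words. -/
def IsLCP {n : ℕ} (A : Set (Cantor n)) (l : List (Fin n)) : Prop :=
  (∀ ρ ∈ A, PrefixOf l ρ) ∧
    ∀ l' : List (Fin n), (∀ ρ ∈ A, PrefixOf l' ρ) → l'.length ≤ l.length

/-- A (not necessarily finite-state) transducer over the alphabet `Fin n`. -/
structure Transducer (n : ℕ) where
  /-- the set of states -/
  Q : Type
  /-- the transition function -/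
  tr : Fin n → Q → Q
  /-- the output (rewrite) function -/
  out : Fin n → Q → List (Fin n)

namespace Transducer

variable {n : ℕ}

/-- The transition function extended to finite words. -/
def transStar (T : Transducer n) : List (Fin n) → T.Q → T.Q
  | [], q => q
  | x :: w, q => T.transStar w (T.tr x q)

/-- The output function extended to finite words. -/
def outStar (T : Transducer n) : List (Fin n) → T.Q → List (Fin n)
  | [], _ => []
  | x :: w, q => T.out x q ++ T.outStar w (T.tr x q)

/-- The initial transducer `T_q` induces the map `f` on Cantor space: the outputs along
ever longer prefixes of `χ` are ever longer prefixes of `f χ`. -/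
def Induces (T : Transducer n) (q : T.Q) (f : Cantor n → Cantor n) : Prop :=
  ∀ (χ : Cantor n) (m : ℕ), ∃ k : ℕ,
    m ≤ (T.outStar (takeW χ k) q).length ∧ PrefixOf (T.outStar (takeW χ k) q) (f χ)

/-- The image of the state `q`: the image of Cantor space under the map induced by `T_q`. -/
def stateImage (T : Transducer n) (q : T.Q) : Set (Cantor n) :=
  {y | ∃ (f : Cantor n → Cantor n) (χ : Cantor n), T.Induces q f ∧ f χ = y}

/-- `T` is synchronizing at level `k`: the state reached after reading any word of
length `k` does not depend on the starting state. -/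
def SyncAtLevel (T : Transducer n) (k : ℕ) : Prop :=
  ∀ w : List (Fin n), w.length = k → ∀ q q' : T.Q, T.transStar w q = T.transStar w q'

/-- `T` is synchronizing if it is synchronizing at some level. -/
def Synchronizing (T : Transducer n) : Prop := ∃ k, T.SyncAtLevel k

/-- `T` (inducing the homeomorphism `h` at `q0`) is one-way synchronizing: `T` is
synchronizing, but the inverse homeomorphism is not induced by any finite
synchronizing transducer (equivalently, the inverse transducer is not synchronizing). -/
def OneWaySync (T : Transducer n) (q0 : T.Q) (h : Cantor n ≃ₜ Cantor n) : Prop :=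
  T.Induces q0 ⇑h ∧ T.Synchronizing ∧
    ¬ ∃ (S : Transducer n) (_ : Finite S.Q) (s0 : S.Q),
        S.Induces s0 ⇑h.symm ∧ S.Synchronizing

/-- `T` is equal to its core : every state is reached by reading a word of length `k`
from some state, for every synchronizing level `k`. -/
def EqualToCore (T : Transducer n) : Prop :=
  ∀ k : ℕ, T.SyncAtLevel k → ∀ q : T.Q, ∃ (w : List (Fin n)) (p : T.Q),
    w.length = k ∧ T.transStar w p = q

/-- Every state of `T` is accessible from `q0`. -/
def Accessible (T : Transducer n) (q0 : T.Q) : Prop :=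
  ∀ q : T.Q, ∃ w : List (Fin n), T.transStar w q0 = q

/-- The product transducer `T S` (first act by `T`, then by `S`). -/
def prod (T S : Transducer n) : Transducer n where
  Q := T.Q × S.Q
  tr := fun x p => (T.tr x p.1, S.transStar (T.out x p.1) p.2)
  out := fun x p => S.outStar (T.out x p.1) p.2

/-- `T` is partially invertible: every state induces an injective map on Cantor space
with clopen image. -/
def PartiallyInvertible (T : Transducer n) : Prop :=
  ∀ q : T.Q, ∃ f : Cantor n → Cantor n,
    T.Induces q f ∧ Function.Injective f ∧ IsClopen (Set.range f)

/-- `T` has no states of incomplete response: for each state `q` and letter `i`, no word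
strictly longer than `λ(i,q)` is a common prefix of the outputs on all of the cone `[i]`. -/
def NoIncompleteResponse (T : Transducer n) : Prop :=
  ∀ (q : T.Q) (i x : Fin n),
    ¬ ∀ χ : Cantor n, ∃ k : ℕ, (T.out i q ++ [x]) <+: T.outStar (i :: takeW χ k) q

/-- States `q` of `T` and `p` of `S` are `ω`-equivalent: they induce one and the same
map on Cantor space. -/
def OmegaEq (T : Transducer n) (q : T.Q) (S : Transducer n) (p : S.Q) : Prop :=
  ∃ f : Cantor n → Cantor n, T.Induces q f ∧ S.Induces p f

/-- `T` is minimal: no states of incomplete response and no pair of distinct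
`ω`-equivalent states. -/
def Minimal (T : Transducer n) : Prop :=
  T.NoIncompleteResponse ∧ ∀ q q' : T.Q, T.OmegaEq q T q' → q = q'

/-- The map on Cantor space induced by the state `q` (junk value if none exists). -/
def inducedMap (T : Transducer n) (q : T.Q) : Cantor n → Cantor n :=
  if h : ∃ f, T.Induces q f then h.choose else id

/-- `𝓛_q(α)`: the longest common prefix of the preimage of the cone `[α]` under `T_q`
(junk value if it does not exist). -/
def lcp (T : Transducer n) (q : T.Q) (α : List (Fin n)) : List (Fin n) :=
  if h : ∃ l, IsLCP {ρ : Cantor n | T.inducedMap q ρ ∈ cone α} l then h.choose else []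

/-- The inverse transducer of `T` given by the inversion algorithm, on the set of all
pairs `(w, q)`: reading `x` from `(w,q)` outputs `𝓛_q(wx)` and moves to
`(wx - λ(𝓛_q(wx), q), π(𝓛_q(wx), q))`. -/
def invT (T : Transducer n) : Transducer n where
  Q := List (Fin n) × T.Q
  tr := fun x p =>
    ((p.1 ++ [x]).drop (T.outStar (T.lcp p.2 (p.1 ++ [x])) p.2).length,
      T.transStar (T.lcp p.2 (p.1 ++ [x])) p.2)
  out := fun x p => T.lcp p.2 (p.1 ++ [x])

/-- Restriction of a transducer to a set of states (transitions leaving the set are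
replaced by junk loops; for transition-closed sets this is the honest restriction). -/
def restrictTo (T : Transducer n) (P : T.Q → Prop) : Transducer n where
  Q := {q : T.Q // P q}
  tr := fun x q => if h : P (T.tr x q.1) then ⟨T.tr x q.1, h⟩ else q
  out := fun x q => T.out x q.1

/-- The set of states reachable from `q0`. -/
def reach (T : Transducer n) (q0 : T.Q) : T.Q → Prop :=
  fun q => ∃ w : List (Fin n), T.transStar w q0 = q

/-- The inverse transducer of the initial transducer `T_{q0}`, with state set the states
accessible from `(ε, q0)`. -/
def invAcc (T : Transducer n) (q0 : T.Q) : Transducer n :=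
  (T.invT).restrictTo ((T.invT).reach ([], q0))

/-- A pair `(w,p)` is good if `[w] ⊆ im(T_p)` and `𝓛_p(w) = ε`. -/
def GoodPair (T : Transducer n) (p : List (Fin n) × T.Q) : Prop :=
  cone p.1 ⊆ T.stateImage p.2 ∧
    IsLCP {ρ : Cantor n | T.inducedMap p.2 ρ ∈ cone p.1} []

/-- The partial inverse `T'` of a partially invertible transducer `T`: the inverse
transducer restricted to the good pairs `(w,p)` with `[w] ⊆ im(T_p)`, `𝓛_p(w) = ε`. -/
def partialInv (T : Transducer n) : Transducer n :=
  (T.invT).restrictTo T.GoodPair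

/-- `h` is a completion of `T`: there are a maximal antichain `η` and an effective viable
combination `(ρ, p)` such that `h` maps `η_i χ` to `ρ_i (χ)T_{p_i}`. -/
def IsCompletion (T : Transducer n) (h : Cantor n ≃ₜ Cantor n) : Prop :=
  ∃ (l : ℕ) (η ρ : Fin l → List (Fin n)) (p : Fin l → T.Q)
      (f : Fin l → (Cantor n → Cantor n)),
    l % (n - 1) = 1 % (n - 1) ∧
    AntichainFam η ∧
    (∀ i, T.Induces (p i) (f i)) ∧
    (⋃ i, appendInf (ρ i) '' Set.range (f i)) = Set.univ ∧
    (∀ i j, i ≠ j →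
      Disjoint (appendInf (ρ i) '' Set.range (f i))
        (appendInf (ρ j) '' Set.range (f j))) ∧
    ∀ (i : Fin l) (χ : Cantor n), h (appendInf (η i) χ) = appendInf (ρ i) (f i χ)

/-- The group `𝓗(T)` generated by all completions of `T`. -/
def HGroup (T : Transducer n) : Subgroup (Cantor n ≃ₜ Cantor n) :=
  Subgroup.closure {h | T.IsCompletion h}

/-- The subgroup-generating equivalence relation induced by the automaton underlying a
transducer `A` with start state `a0` (by Lemma 4.1, two words are related iff the states
they reach are identified by the collapsing procedure, i.e. iff the reached states
transition identically on all sufficiently long words). -/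
def simA (A : Transducer n) (a0 : A.Q) (α β : List (Fin n)) : Prop :=
  ∃ i : ℕ, ∀ w : List (Fin n), w.length = i →
    A.transStar w (A.transStar α a0) = A.transStar w (A.transStar β a0)

/-- `if b then T else T'`. -/
def factor (T : Transducer n) (b : Bool) : Transducer n :=
  if b then T else T.partialInv

/-- The product of a nonempty list of factors, each equal to `T` or its partial
inverse `T'`; these products make up the set `Π(T)`. -/
def prodOf (T : Transducer n) : List Bool → Transducer n
  | [] => T
  | [b] => T.factor b
  | b :: c :: rest => (T.factor b).prod (T.prodOf (c :: rest))

/-- `T` is contracting: every state of every product of copies of `T` and `T'` is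
`ω`-equivalent to an initial transducer which, after reading some fixed length of input,
always acts as a state of `T`. -/
def Contracting (T : Transducer n) : Prop :=
  ∀ L : List Bool, L ≠ [] → ∀ q : (T.prodOf L).Q,
    ∃ (V : Transducer n) (p : V.Q) (f : Cantor n → Cantor n),
      (T.prodOf L).Induces q f ∧ V.Induces p f ∧
      ∃ j : ℕ, ∀ w : List (Fin n), w.length = j →
        ∃ (u : T.Q) (g : Cantor n → Cantor n),
          V.Induces (V.transStar w p) g ∧ T.Induces u g

end Transducer

/-- The element `v` of `Vₙ` preserves the relation `r` on nonempty finite words: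
whenever `v` replaces the prefix `α` by `β`, the words `α` and `β` are related. -/
def PreservesRel {n : ℕ} (r : List (Fin n) → List (Fin n) → Prop)
    (g : Cantor n ≃ₜ Cantor n) : Prop :=
  ∀ (α β : List (Fin n)), α ≠ [] → β ≠ [] →
    (∀ χ : Cantor n, g (appendInf α χ) = appendInf β χ) → r α β

/-- The subgroup `V_∼` of `Vₙ` generated by the prefix-exchange homeomorphisms
preserving the relation `r`. -/
def VSim (n : ℕ) (r : List (Fin n) → List (Fin n) → Prop) :
    Subgroup (Cantor n ≃ₜ Cantor n) :=
  Subgroup.closure {g | g ∈ Vn n ∧ PreservesRel r g}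

/-- `f` coincides with `g` on the cone `[α]` (conjugated into the cone) and is the
identity off the cone: the homeomorphism `[α]_g`. -/
def IsRestrTo {n : ℕ} (α : List (Fin n)) (g f : Cantor n ≃ₜ Cantor n) : Prop :=
  (∀ χ : Cantor n, f (appendInf α χ) = appendInf α (g χ)) ∧
  ∀ χ : Cantor n, ¬ PrefixOf α χ → f χ = χ

/-- The Nekrashevych group `Vₙ(G)`: the group generated by `Vₙ` together with all the
homeomorphisms `[α]_g` for `g ∈ G`. -/
def NekG (n : ℕ) (G : Subgroup (Cantor n ≃ₜ Cantor n)) :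
    Subgroup (Cantor n ≃ₜ Cantor n) :=
  Subgroup.closure (Vn n ∪ {f | ∃ (α : List (Fin n)) (g : Cantor n ≃ₜ Cantor n),
    g ∈ G ∧ IsRestrTo α g f})

/-- The homeomorphism `f` locally agrees with the set `G` of homeomorphisms. -/
def LocallyAgrees {n : ℕ} (G : Set (Cantor n ≃ₜ Cantor n))
    (f : Cantor n ≃ₜ Cantor n) : Prop :=
  ∀ x : Cantor n, ∃ U : Set (Cantor n), IsOpen U ∧ x ∈ U ∧
    ∃ g ∈ G, Set.EqOn ⇑f ⇑g U

/-- A finite synchronous invertible transducer over `Fin n`: each state rewrites single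
letters to single letters bijectively. -/
structure SyncTransducer (n : ℕ) where
  /-- the set of states -/
  Q : Type
  /-- there are finitely many states -/
  fin : Finite Q
  /-- the transition function -/
  tr : Fin n → Q → Q
  /-- the (single-letter) output function -/
  out : Fin n → Q → Fin n
  /-- each state rewrites letters bijectively -/
  bij : ∀ q : Q, Function.Bijective fun x => out x q

namespace SyncTransducer

variable {n : ℕ}

/-- The transition function extended to finite words. -/
def trStar (U : SyncTransducer n) : List (Fin n) → U.Q → U.Q
  | [], q => q
  | x :: w, q => U.trStar w (U.tr x q)

/-- The output function extended to finite words. -/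
def outWord (U : SyncTransducer n) : List (Fin n) → U.Q → List (Fin n)
  | [], _ => []
  | x :: w, q => U.out x q :: U.outWord w (U.tr x q)

/-- The map on Cantor space induced by the initial transducer `U_q`. -/
def applyFun (U : SyncTransducer n) (q : U.Q) (χ : Cantor n) : Cantor n :=
  fun i => U.out (χ i) (U.trStar (takeW χ i) q)

/-- The inverse transducer of a synchronous invertible transducer. -/
def inv (U : SyncTransducer n) : SyncTransducer n where
  Q := U.Q
  fin := U.fin
  tr := fun y q => U.tr ((Equiv.ofBijective _ (U.bij q)).symm y) q
  out := fun y q => (Equiv.ofBijective _ (U.bij q)).symm y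
  bij := fun q => (Equiv.ofBijective _ (U.bij q)).symm.bijective

/-- The product of synchronous transducers (first act by `T`, then by `S`). -/
def sprod (T S : SyncTransducer n) : SyncTransducer n where
  Q := T.Q × S.Q
  fin := by
    haveI := T.fin; haveI := S.fin
    infer_instance
  tr := fun x p => (T.tr x p.1, S.tr (T.out x p.1) p.2)
  out := fun x p => S.out (T.out x p.1) p.2
  bij := fun p => (S.bij p.2).comp (T.bij p.1)

/-- `U` is synchronizing at level `k`. -/
def SyncAtLevel (U : SyncTransducer n) (k : ℕ) : Prop :=
  ∀ w : List (Fin n), w.length = k → ∀ q q' : U.Q, U.trStar w q = U.trStar w q'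

/-- `U` is synchronizing. -/
def Synchronizing (U : SyncTransducer n) : Prop := ∃ k, U.SyncAtLevel k

/-- `U` is minimal (under `ω`-equivalence): distinct states induce distinct maps. -/
def Minimal (U : SyncTransducer n) : Prop :=
  ∀ q q' : U.Q, U.applyFun q = U.applyFun q' → q = q'

/-- One-way synchronizing: `U` is synchronizing but the inverse homeomorphism of
`h = U_{q0}` is not induced by any finite synchronizing transducer. -/
def OneWaySync (U : SyncTransducer n) (h : Cantor n ≃ₜ Cantor n) : Prop :=
  U.Synchronizing ∧
    ¬ ∃ (S : Transducer n) (_ : Finite S.Q) (s0 : S.Q),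
        S.Induces s0 ⇑h.symm ∧ S.Synchronizing

/-- `U` is equal to its core. -/
def EqualToCore (U : SyncTransducer n) : Prop :=
  ∀ k : ℕ, U.SyncAtLevel k → ∀ q : U.Q, ∃ (w : List (Fin n)) (p : U.Q),
    w.length = k ∧ U.trStar w p = q

/-- The underlying (asynchronous-format) transducer of a synchronous transducer. -/
def toT (U : SyncTransducer n) : Transducer n :=
  ⟨U.Q, U.tr, fun x q => [U.out x q]⟩

/-- The automaton group `𝒢(U)` generated by `U`: the subgroup of the homeomorphism
group of Cantor space generated by the homeomorphisms `U_q` for the states `q`. -/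
def autG (U : SyncTransducer n) : Subgroup (Cantor n ≃ₜ Cantor n) :=
  Subgroup.closure {f : Cantor n ≃ₜ Cantor n | ∃ q : U.Q, ⇑f = U.applyFun q}

end SyncTransducer

section Words

variable {n : ℕ}

theorem prefixOf_iff_exists {w : List (Fin n)} {χ : Cantor n} :
    PrefixOf w χ ↔ ∃ δ, χ = appendInf w δ := by
  constructor
  · intro hw
    refine ⟨fun i => χ (i + w.length), funext fun i => ?_⟩
    by_cases hi : i < w.length
    · simpa [appendInf, hi] using (hw i hi).symm
    · simp [appendInf, hi, Nat.sub_add_cancel (not_lt.mp hi)]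
  · rintro ⟨δ, rfl⟩ i hi
    simp [appendInf, hi]

theorem prefixOf_appendInf (w : List (Fin n)) (χ : Cantor n) : PrefixOf w (appendInf w χ) :=
  prefixOf_iff_exists.2 ⟨χ, rfl⟩

theorem prefixOf_nil (χ : Cantor n) : PrefixOf [] χ := fun i hi => absurd hi (by simp)

@[simp]
theorem appendInf_nil (χ : Cantor n) : appendInf [] χ = χ := by
  funext i
  simp [appendInf]

theorem appendInf_append (u v : List (Fin n)) (χ : Cantor n) :
    appendInf (u ++ v) χ = appendInf u (appendInf v χ) := by
  funext i
  simp only [appendInf, List.get_eq_getElem, List.length_append]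
  by_cases hu : i < u.length
  · have : i < u.length + v.length := by omega
    simp [hu, this, List.getElem_append_left]
  · by_cases hv : i < u.length + v.length
    · have : i - u.length < v.length := by omega
      simp [hu, hv, this, List.getElem_append_right (not_lt.mp hu)]
    · have : ¬ i - u.length < v.length := by omega
      simp [hu, hv, this, Nat.sub_sub]

theorem appendInf_injective (w : List (Fin n)) : Function.Injective (appendInf w) := by
  intro χ χ' hχ
  funext i
  have := congrFun hχ (i + w.length)
  simpa [appendInf] using this

theorem PrefixOf.exists_append {u v : List (Fin n)} {χ : Cantor n} (hu : PrefixOf u χ)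
    (hv : PrefixOf v χ) (huv : u.length ≤ v.length) : ∃ e, v = u ++ e := by
  refine ⟨v.drop u.length, ?_⟩
  have : u = v.take u.length := by
    apply List.ext_getElem
    · simp [huv]
    · intro i hi hi'
      have h₁ := hu i hi
      have h₂ := hv i (by omega)
      simp only [List.get_eq_getElem] at h₁ h₂
      simp [h₁, h₂]
  conv_rhs => lhs; rw [this]
  simp

theorem PrefixOf.of_append {u v : List (Fin n)} {χ : Cantor n} (h : PrefixOf (u ++ v) χ) :
    PrefixOf u χ := by
  obtain ⟨δ, rfl⟩ := prefixOf_iff_exists.1 h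
  rw [appendInf_append]
  exact prefixOf_appendInf _ _

theorem prefixOf_append_appendInf {u v : List (Fin n)} {χ : Cantor n} :
    PrefixOf (u ++ v) (appendInf u χ) ↔ PrefixOf v χ := by
  simp only [prefixOf_iff_exists, appendInf_append, (appendInf_injective u).eq_iff]

@[simp]
theorem takeW_length (χ : Cantor n) (k : ℕ) : (takeW χ k).length = k := by
  simp [takeW]

theorem prefixOf_takeW (χ : Cantor n) (k : ℕ) : PrefixOf (takeW χ k) χ := by
  intro i hi
  simp [takeW]

theorem PrefixOf.takeW_eq {w : List (Fin n)} {χ : Cantor n} (h : PrefixOf w χ) :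
    takeW χ w.length = w := by
  obtain ⟨e, he⟩ := (prefixOf_takeW χ w.length).exists_append h (by simp)
  have : e = [] := by
    have := congrArg List.length he
    simpa using this
  simpa [this] using he.symm

theorem takeW_appendInf (w : List (Fin n)) (χ : Cantor n) :
    takeW (appendInf w χ) w.length = w :=
  (prefixOf_appendInf w χ).takeW_eq

theorem takeW_add_appendInf (w : List (Fin n)) (χ : Cantor n) (k : ℕ) :
    takeW (appendInf w χ) (w.length + k) = w ++ takeW χ k := by
  have h := PrefixOf.takeW_eq (prefixOf_append_appendInf.2 (prefixOf_takeW χ k) :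
    PrefixOf (w ++ takeW χ k) (appendInf w χ))
  simpa using h

theorem exists_takeW_eq_append (χ : Cantor n) {k l : ℕ} (hkl : k ≤ l) :
    ∃ e, takeW χ l = takeW χ k ++ e :=
  (prefixOf_takeW χ k).exists_append (prefixOf_takeW χ l) (by simpa using hkl)

theorem eq_of_forall_takeW {χ χ' : Cantor n}
    (h : ∀ m, ∃ w : List (Fin n), m ≤ w.length ∧ PrefixOf w χ ∧ PrefixOf w χ') : χ = χ' := by
  funext i
  obtain ⟨w, hw, h₁, h₂⟩ := h (i + 1)
  rw [← h₁ i hw, ← h₂ i hw]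

theorem isOpen_setOf_takeW (p : List (Fin n) → Prop) (k : ℕ) :
    IsOpen {χ : Cantor n | p (takeW χ k)} := by
  have : Continuous fun χ : Cantor n => fun i : Fin k => χ i := by fun_prop
  exact (isOpen_discrete {a : Fin k → Fin n | p (List.ofFn a)}).preimage this

theorem cone_eq (w : List (Fin n)) : cone w = {χ | takeW χ w.length = w} := by
  ext χ
  exact ⟨fun h => h.takeW_eq, fun h => h ▸ prefixOf_takeW χ w.length⟩

theorem isOpen_cone (w : List (Fin n)) : IsOpen (cone w) :=
  cone_eq w ▸ isOpen_setOf_takeW (· = w) w.length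

theorem isClosed_cone (w : List (Fin n)) : IsClosed (cone w) := by
  rw [← isOpen_compl_iff, cone_eq]
  exact isOpen_setOf_takeW (· ≠ w) w.length

theorem exists_cone_takeW_subset {V : Set (Cantor n)} (hV : IsOpen V) {χ : Cantor n}
    (hχ : χ ∈ V) : ∃ m, cone (takeW χ m) ⊆ V := by
  obtain ⟨s, u, hu, hs⟩ := isOpen_pi_iff.1 hV χ hχ
  refine ⟨s.sup id + 1, fun χ' hχ' => hs fun i hi => ?_⟩
  have hlt : i < (takeW χ (s.sup id + 1)).length := by
    simpa using Nat.lt_succ_of_le (Finset.le_sup (f := id) hi)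
  rw [← hχ' i hlt, prefixOf_takeW χ _ i hlt]
  exact (hu i hi).2

/-- A property of finite words that is inherited by extensions and eventually holds along every
infinite word holds for all words of some positive length. -/
theorem exists_length_forall_of_forall_takeW (hn : 2 ≤ n) {p : List (Fin n) → Prop}
    (hmono : ∀ u v, p u → p (u ++ v)) (hp : ∀ χ : Cantor n, ∃ k, p (takeW χ k)) :
    ∃ j, 0 < j ∧ ∀ w : List (Fin n), w.length = j → p w := by
  have hmono' : ∀ k l, k ≤ l → {χ : Cantor n | p (takeW χ k)} ⊆ {χ | p (takeW χ l)} := by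
    intro k l hkl χ hχ
    obtain ⟨e, he⟩ := exists_takeW_eq_append χ hkl
    simpa only [Set.mem_ofPred_eq, he] using hmono _ _ hχ
  obtain ⟨j, hj⟩ := isCompact_univ.elim_directed_cover
    (fun k => {χ : Cantor n | p (takeW χ k)}) (isOpen_setOf_takeW p)
    (fun χ _ => Set.mem_iUnion.2 (hp χ))
    (directed_of_isDirected_le hmono')
  refine ⟨j + 1, j.succ_pos, fun w hw => ?_⟩
  have h := hmono' j (j + 1) j.le_succ
    (hj (Set.mem_univ (appendInf w fun _ => ⟨0, by omega⟩)))
  rwa [Set.mem_ofPred_eq, ← hw, takeW_appendInf] at h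

theorem exists_appendInf_ne (hn : 2 ≤ n) (w : List (Fin n)) (x : Fin n) :
    ∃ δ : Cantor n, δ 0 ≠ x ∧ appendInf w δ ∈ cone w := by
  have : Nontrivial (Fin n) := Fin.nontrivial_iff_two_le.2 hn
  obtain ⟨y, hy⟩ := exists_ne x
  exact ⟨fun _ => y, hy, prefixOf_appendInf w _⟩

/-- Words that prefix every member of a cone are prefixes of its defining word. -/
theorem exists_append_of_cone_subset (hn : 2 ≤ n) {u w : List (Fin n)}
    (h : cone w ⊆ cone u) : ∃ e, w = u ++ e := by
  have hne : ∀ x, ∃ δ : Cantor n, δ 0 ≠ x ∧ PrefixOf u (appendInf w δ) := fun x => by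
    obtain ⟨δ, hδ, hw⟩ := exists_appendInf_ne hn w x
    exact ⟨δ, hδ, h hw⟩
  obtain ⟨δ, -, hδ⟩ := hne ⟨0, by omega⟩
  refine hδ.exists_append (prefixOf_appendInf w δ) (not_lt.1 fun hlt => ?_)
  obtain ⟨δ', hδ', hu'⟩ := hne (u.get ⟨w.length, hlt⟩)
  exact hδ' (by simpa [appendInf] using (hu' w.length hlt).symm)

theorem IsLCP.eq {A : Set (Cantor n)} {l l' : List (Fin n)} (hA : A.Nonempty)
    (h : IsLCP A l) (h' : IsLCP A l') : l = l' := by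
  obtain ⟨ρ, hρ⟩ := hA
  rw [← (h.1 ρ hρ).takeW_eq, ← (h'.1 ρ hρ).takeW_eq, le_antisymm (h'.2 l h.1) (h.2 l' h'.1)]

/-- A set with two elements has a longest common prefix. -/
theorem exists_isLCP {A : Set (Cantor n)} (hA : A.Nontrivial) : ∃ l, IsLCP A l := by
  obtain ⟨ρ, hρ, ρ', hρ', hne⟩ := hA
  obtain ⟨i, hi⟩ := Function.ne_iff.1 hne
  have hbound : ∀ l : List (Fin n), (∀ ρ ∈ A, PrefixOf l ρ) → l.length ≤ i := by
    intro l hl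
    by_contra! hlt
    exact hi (by rw [← hl ρ hρ i hlt, ← hl ρ' hρ' i hlt])
  let s : Set ℕ := {k | ∃ l : List (Fin n), l.length = k ∧ ∀ ρ ∈ A, PrefixOf l ρ}
  have hs : s.Nonempty := ⟨0, [], rfl, fun ρ _ => prefixOf_nil ρ⟩
  have hbdd : BddAbove s := ⟨i, by rintro k ⟨l, rfl, hl⟩; exact hbound l hl⟩
  obtain ⟨l, hlen, hl⟩ := Nat.sSup_mem hs hbdd
  exact ⟨l, hl, fun l' hl' => hlen ▸ le_csSup hbdd ⟨l', rfl, hl'⟩⟩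

/-- Longest common prefixes are compatible with adding a prefix. -/
theorem isLCP_image_appendInf {A : Set (Cantor n)} (hA : A.Nonempty) (u l : List (Fin n)) :
    IsLCP (appendInf u '' A) (u ++ l) ↔ IsLCP A l := by
  simp only [IsLCP, Set.forall_mem_image, prefixOf_append_appendInf]
  refine and_congr_right fun _ => ⟨fun h l' hl' => ?_, fun h l' hl' => ?_⟩
  · simpa using h (u ++ l') fun ρ hρ => prefixOf_append_appendInf.2 (hl' ρ hρ)
  · obtain ⟨ρ, hρ⟩ := hA
    rcases le_total l'.length u.length with hle | hle
    · simp only [List.length_append]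
      omega
    · obtain ⟨e, rfl⟩ := (prefixOf_appendInf u ρ).exists_append (hl' hρ) hle
      simpa using h e fun ρ hρ => prefixOf_append_appendInf.1 (hl' hρ)

end Words

namespace Transducer

variable {n : ℕ}

section Induces

variable {T S : Transducer n} {f g : Cantor n → Cantor n}

theorem transStar_append (T : Transducer n) (u v : List (Fin n)) (q : T.Q) :
    T.transStar (u ++ v) q = T.transStar v (T.transStar u q) := by
  induction u generalizing q with
  | nil => rfl
  | cons x u ih => exact ih _

theorem outStar_append (T : Transducer n) (u v : List (Fin n)) (q : T.Q) :
    T.outStar (u ++ v) q = T.outStar u q ++ T.outStar v (T.transStar u q) := by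
  induction u generalizing q with
  | nil => rfl
  | cons x u ih => simp [outStar, transStar, ih]

theorem exists_outStar_takeW_eq_append (T : Transducer n) (q : T.Q) (χ : Cantor n) {k l : ℕ}
    (hkl : k ≤ l) : ∃ e, T.outStar (takeW χ l) q = T.outStar (takeW χ k) q ++ e := by
  obtain ⟨e, he⟩ := exists_takeW_eq_append χ hkl
  exact ⟨_, by rw [he, outStar_append]⟩

theorem Induces.prefixOf_takeW {q : T.Q} (hf : T.Induces q f) (χ : Cantor n) (k : ℕ) :
    PrefixOf (T.outStar (takeW χ k) q) (f χ) := by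
  obtain ⟨l, hl, hpre⟩ := hf χ (T.outStar (takeW χ k) q).length
  rcases le_total k l with hkl | hlk
  · obtain ⟨e, he⟩ := T.exists_outStar_takeW_eq_append q χ hkl
    exact (he ▸ hpre).of_append
  · obtain ⟨e, he⟩ := T.exists_outStar_takeW_eq_append q χ hlk
    rw [he] at hl ⊢
    have : e = [] := by simpa using hl
    simpa [this] using hpre

theorem Induces.prefixOf {q : T.Q} (hf : T.Induces q f) (w : List (Fin n)) (χ : Cantor n) :
    PrefixOf (T.outStar w q) (f (appendInf w χ)) := by
  simpa [takeW_appendInf] using hf.prefixOf_takeW (appendInf w χ) w.length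

theorem Induces.unique {q : T.Q} (hf : T.Induces q f) (hg : T.Induces q g) : f = g := by
  refine funext fun χ => eq_of_forall_takeW fun m => ?_
  obtain ⟨k, hk, hpre⟩ := hf χ m
  exact ⟨_, hk, hpre, hg.prefixOf_takeW χ k⟩

theorem Induces.continuous {q : T.Q} (hf : T.Induces q f) : Continuous f := by
  refine continuous_pi fun i => IsLocallyConstant.continuous
    ((IsLocallyConstant.iff_exists_open _).2 fun χ => ?_)
  obtain ⟨k, hk, hpre⟩ := hf χ (i + 1)
  refine ⟨{χ' | takeW χ' k = takeW χ k}, isOpen_setOf_takeW (· = takeW χ k) k, rfl,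
    fun χ' hχ' => ?_⟩
  have h' := hf.prefixOf_takeW χ' k
  rw [show takeW χ' k = takeW χ k from hχ'] at h'
  rw [← h' i hk, ← hpre i hk]

theorem Induces.exists_transStar {q : T.Q} (hf : T.Induces q f) (w : List (Fin n)) :
    ∃ g, T.Induces (T.transStar w q) g ∧
      ∀ χ, f (appendInf w χ) = appendInf (T.outStar w q) (g χ) := by
  choose g hg using fun χ => prefixOf_iff_exists.1 (hf.prefixOf w χ)
  refine ⟨g, fun χ m => ?_, hg⟩
  obtain ⟨k, hk, -⟩ := hf (appendInf w χ) ((T.outStar w q).length + m)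
  obtain ⟨e, he⟩ := T.exists_outStar_takeW_eq_append q (appendInf w χ)
    (Nat.le_add_left k w.length)
  have hout := hf.prefixOf_takeW (appendInf w χ) (w.length + k)
  have hlen := congrArg List.length he
  rw [takeW_add_appendInf, outStar_append] at hout hlen
  refine ⟨k, ?_, ?_⟩
  · simp only [List.length_append] at hlen
    omega
  · rwa [hg, prefixOf_append_appendInf] at hout

theorem Induces.of_forall_length {q : T.Q} (j : ℕ)
    (h : ∀ w : List (Fin n), w.length = j → ∃ g, T.Induces (T.transStar w q) g ∧
      ∀ χ, f (appendInf w χ) = appendInf (T.outStar w q) (g χ)) : T.Induces q f := by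
  intro χ m
  obtain ⟨δ, hδ⟩ := prefixOf_iff_exists.1 (_root_.prefixOf_takeW χ j)
  have hlen := takeW_length χ j
  generalize takeW χ j = w at hδ hlen
  subst hδ
  obtain ⟨g, hg, hfg⟩ := h w hlen
  obtain ⟨k, hk, hpre⟩ := hg δ m
  refine ⟨w.length + k, ?_, ?_⟩
  · rw [takeW_add_appendInf, outStar_append, List.length_append]
    omega
  · rw [takeW_add_appendInf, outStar_append, hfg]
    exact prefixOf_append_appendInf.2 hpre

theorem outStar_prod (T S : Transducer n) (w : List (Fin n)) (q : T.Q) (s : S.Q) :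
    (T.prod S).outStar w (q, s) = S.outStar (T.outStar w q) s := by
  induction w generalizing q s with
  | nil => rfl
  | cons x w ih => simp only [outStar, outStar_append]; exact congrArg _ (ih _ _)

theorem Induces.prod {q : T.Q} {s : S.Q} (hf : T.Induces q f) (hg : S.Induces s g) :
    (T.prod S).Induces (q, s) (g ∘ f) := by
  intro χ m
  obtain ⟨k, hk, -⟩ := hg (f χ) m
  obtain ⟨l, hl, hpre⟩ := hf χ k
  have heq := hpre.takeW_eq
  obtain ⟨e, he⟩ := S.exists_outStar_takeW_eq_append s (f χ) hl
  have hpre' := hg.prefixOf_takeW (f χ) (T.outStar (takeW χ l) q).length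
  refine ⟨l, ?_, ?_⟩
  · rw [outStar_prod, ← heq, he, List.length_append]
    omega
  · rwa [outStar_prod, ← heq]

theorem Induces.inducedMap_eq {q : T.Q} (hf : T.Induces q f) : T.inducedMap q = f := by
  have h : ∃ f, T.Induces q f := ⟨f, hf⟩
  rw [inducedMap, dif_pos h]
  exact h.choose_spec.unique hf

theorem Induces.stateImage_eq {q : T.Q} (hf : T.Induces q f) : T.stateImage q = Set.range f := by
  ext y
  constructor
  · rintro ⟨f', χ, hf', rfl⟩
    exact ⟨χ, by rw [hf.unique hf']⟩
  · rintro ⟨χ, rfl⟩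
    exact ⟨f, χ, hf, rfl⟩

theorem Induces.goodPair_iff {q : T.Q} (hf : T.Induces q f) {w : List (Fin n)} :
    T.GoodPair (w, q) ↔ cone w ⊆ Set.range f ∧ IsLCP {ρ | f ρ ∈ cone w} [] := by
  rw [GoodPair, hf.stateImage_eq, hf.inducedMap_eq]

end Induces

section Inversion

variable {U : Transducer n} {f f' : Cantor n → Cantor n}

theorem preimage_cone_append {u o w : List (Fin n)}
    (hf : ∀ χ, f (appendInf u χ) = appendInf o (f' χ))
    (hu : ∀ ρ, f ρ ∈ cone (o ++ w) → PrefixOf u ρ) :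
    {ρ | f ρ ∈ cone (o ++ w)} = appendInf u '' {χ | f' χ ∈ cone w} := by
  have hmem : ∀ χ, f (appendInf u χ) ∈ cone (o ++ w) ↔ f' χ ∈ cone w := fun χ => by
    rw [hf]
    exact prefixOf_append_appendInf
  ext ρ
  constructor
  · intro hρ
    obtain ⟨χ, rfl⟩ := prefixOf_iff_exists.1 (hu ρ hρ)
    exact ⟨χ, (hmem χ).1 hρ, rfl⟩
  · rintro ⟨χ, hχ, rfl⟩
    exact (hmem χ).2 hχ

theorem cone_nontrivial (hn : 2 ≤ n) (w : List (Fin n)) : (cone w).Nontrivial := by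
  obtain ⟨δ, -, hδ⟩ := exists_appendInf_ne hn w ⟨0, by omega⟩
  obtain ⟨δ', hne, hδ'⟩ := exists_appendInf_ne hn w (δ 0)
  exact ⟨_, hδ, _, hδ', fun heq => hne (congrFun (appendInf_injective w heq) 0).symm⟩

theorem preimage_cone_nontrivial (hn : 2 ≤ n) {w : List (Fin n)} (hw : cone w ⊆ Set.range f) :
    {ρ | f ρ ∈ cone w}.Nontrivial :=
  Set.nontrivial_of_image f _ (by
    rw [show {ρ | f ρ ∈ cone w} = f ⁻¹' cone w from rfl, Set.image_preimage_eq_of_subset hw]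
    exact cone_nontrivial hn w)

theorem Induces.isLCP_lcp {q : U.Q} (hf : U.Induces q f) (hn : 2 ≤ n) {w : List (Fin n)}
    (hw : cone w ⊆ Set.range f) : IsLCP {ρ | f ρ ∈ cone w} (U.lcp q w) := by
  have h := exists_isLCP (preimage_cone_nontrivial hn hw)
  have h' : ∃ l, IsLCP {ρ | U.inducedMap q ρ ∈ cone w} l := by rwa [hf.inducedMap_eq]
  rw [lcp, dif_pos h']
  simpa only [hf.inducedMap_eq] using h'.choose_spec

/-- One step of the inversion algorithm starting from an arbitrary cone inside the image. -/
theorem Induces.goodPair_drop {q : U.Q} (hf : U.Induces q f) (hn : 2 ≤ n) {w : List (Fin n)}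
    (hw : cone w ⊆ Set.range f) :
    U.outStar (U.lcp q w) q ++ w.drop (U.outStar (U.lcp q w) q).length = w ∧
      U.GoodPair (w.drop (U.outStar (U.lcp q w) q).length, U.transStar (U.lcp q w) q) := by
  have hL := hf.isLCP_lcp hn hw
  generalize U.lcp q w = L at hL
  obtain ⟨f', hf', hff'⟩ := hf.exists_transStar L
  obtain ⟨w', rfl⟩ : ∃ w', w = U.outStar L q ++ w' := by
    refine exists_append_of_cone_subset hn fun y hy => ?_
    obtain ⟨ρ, rfl⟩ := hw hy
    obtain ⟨χ, rfl⟩ := prefixOf_iff_exists.1 (hL.1 ρ hy)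
    exact hf.prefixOf L χ
  have hpre := preimage_cone_append hff' hL.1
  have hw' : cone w' ⊆ Set.range f' := fun y hy => by
    have hy' : appendInf (U.outStar L q) y ∈ cone (U.outStar L q ++ w') :=
      prefixOf_append_appendInf.2 hy
    obtain ⟨ρ, hρ⟩ := hw hy'
    obtain ⟨χ, rfl⟩ := prefixOf_iff_exists.1 (hL.1 ρ (by rwa [Set.mem_ofPred_eq, hρ]))
    rw [hff'] at hρ
    exact ⟨χ, appendInf_injective _ hρ⟩
  rw [hpre] at hL
  simp only [List.drop_left, true_and]
  refine hf'.goodPair_iff.2 ⟨hw', ?_⟩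
  rw [← isLCP_image_appendInf (preimage_cone_nontrivial hn hw').nonempty L]
  simpa using hL

theorem cone_append_subset (u v : List (Fin n)) : cone (u ++ v) ⊆ cone u :=
  fun _ h => PrefixOf.of_append h

theorem GoodPair.invT_tr (hn : 2 ≤ n) (hU : ∀ q, ∃ f, U.Induces q f)
    {p : List (Fin n) × U.Q} (hp : U.GoodPair p) (x : Fin n) : U.GoodPair (U.invT.tr x p) := by
  obtain ⟨f, hf⟩ := hU p.2
  exact (hf.goodPair_drop hn
    ((cone_append_subset p.1 [x]).trans (hf.goodPair_iff.1 hp).1)).2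

theorem GoodPair.invT_transStar (hn : 2 ≤ n) (hU : ∀ q, ∃ f, U.Induces q f)
    {p : List (Fin n) × U.Q} (hp : U.GoodPair p) (v : List (Fin n)) :
    U.GoodPair (U.invT.transStar v p) := by
  induction v generalizing p with
  | nil => exact hp
  | cons x v ih => exact ih (hp.invT_tr hn hU x)

theorem GoodPair.isLCP_outStar (hn : 2 ≤ n) {p : List (Fin n) × U.Q} (hp : U.GoodPair p)
    (hf : U.Induces p.2 f) (v : List (Fin n)) :
    IsLCP {ρ | f ρ ∈ cone (p.1 ++ v)} (U.invT.outStar v p) := by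
  induction v generalizing p f with
  | nil => simpa [outStar] using (hf.goodPair_iff.1 hp).2
  | cons x v ih =>
    have hx := (cone_append_subset p.1 [x]).trans (hf.goodPair_iff.1 hp).1
    obtain ⟨happ, hgood⟩ := hf.goodPair_drop hn hx
    have hL := hf.isLCP_lcp hn hx
    obtain ⟨f', hf', hff'⟩ := hf.exists_transStar (U.lcp p.2 (p.1 ++ [x]))
    have key := ih (p := U.invT.tr x p) hgood hf'
    have hw : p.1 ++ x :: v = U.outStar (U.lcp p.2 (p.1 ++ [x])) p.2 ++
        ((U.invT.tr x p).1 ++ v) := by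
      rw [← List.append_assoc, show _ ++ (U.invT.tr x p).1 = _ from happ]
      simp
    have hne : {χ | f' χ ∈ cone ((U.invT.tr x p).1 ++ v)}.Nonempty :=
      (preimage_cone_nontrivial hn
        ((cone_append_subset _ v).trans (hf'.goodPair_iff.1 hgood).1)).nonempty
    rw [hw, preimage_cone_append hff']
    · exact (isLCP_image_appendInf hne _ _).2 key
    · intro ρ hρ
      refine hL.1 ρ (cone_append_subset _ v ?_)
      rwa [← hw, ← List.singleton_append, ← List.append_assoc] at hρ

theorem outStar_restrictTo {P : U.Q → Prop} (hP : ∀ x q, P q → P (U.tr x q))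
    (w : List (Fin n)) (q : {q : U.Q // P q}) :
    (U.restrictTo P).outStar w q = U.outStar w q.1 := by
  induction w generalizing q with
  | nil => rfl
  | cons x w ih =>
    refine (congrArg _ (ih _)).trans ?_
    simp only [restrictTo, outStar]
    rw [dif_pos (hP x q.1 q.2)]

/-- A good pair `(w, q)` induces the partial inverse `δ ↦ (w δ) U_q⁻¹`. -/
theorem exists_induces_restrictTo_invT (hn : 2 ≤ n) {P : List (Fin n) × U.Q → Prop}
    (hgood : ∀ p, P p → U.GoodPair p)
    (hP : ∀ x p, P p → P (U.invT.tr x p)) (p : {p // P p}) (hf : U.Induces p.1.2 f)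
    (hinj : Function.Injective f) :
    ∃ g, (U.invT.restrictTo P).Induces p g ∧ ∀ δ, f (g δ) = appendInf p.1.1 δ := by
  have hp := hgood p.1 p.2
  choose g hg using fun δ => (hf.goodPair_iff.1 hp).1 (prefixOf_appendInf p.1.1 δ)
  refine ⟨g, fun δ m => ?_, hg⟩
  let A : ℕ → Set (Cantor n) := fun k => {ρ | f ρ ∈ cone (p.1.1 ++ takeW δ k)}
  have hlcp : ∀ k, IsLCP (A k) ((U.invT.restrictTo P).outStar (takeW δ k) p) := fun k => by
    rw [outStar_restrictTo (U := U.invT) hP (takeW δ k) p]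
    exact hp.isLCP_outStar hn hf _
  have hgA : ∀ k, g δ ∈ A k := fun k => by
    simp only [A, Set.mem_ofPred_eq, hg]
    exact prefixOf_append_appendInf.2 (prefixOf_takeW δ k)
  have hclosed : ∀ k, IsClosed (A k) := fun k => (isClosed_cone _).preimage hf.continuous
  have hanti : Antitone A := fun k l hkl ρ hρ => by
    obtain ⟨e, he⟩ := exists_takeW_eq_append δ hkl
    simp only [A, he, ← List.append_assoc] at hρ ⊢
    exact cone_append_subset _ e hρ
  obtain ⟨k, hk⟩ := exists_subset_nhds_of_isCompact' (V := A) (U := cone (takeW (g δ) m))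
    (directed_of_isDirected_le hanti)
    (fun k => (hclosed k).isCompact) hclosed (fun ρ hρ => by
      have hρ' : ρ = g δ := hinj <| (hg δ).symm ▸ eq_of_forall_takeW fun m =>
        ⟨p.1.1 ++ takeW δ m, by simp, Set.mem_iInter.1 hρ m,
          prefixOf_append_appendInf.2 (prefixOf_takeW δ m)⟩
      exact (isOpen_cone _).mem_nhds (hρ' ▸ prefixOf_takeW (g δ) m))
  exact ⟨k, by simpa using (hlcp k).2 _ hk, (hlcp k).1 _ (hgA k)⟩

end Inversion

end Transducer

/-- `F` is locally a prefix replacement: near every point it has the form `b δ ↦ c δ`. -/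
def LocallyPrefixReplacing {n : ℕ} (F : Cantor n → Cantor n) : Prop :=
  ∀ y, ∃ b c : List (Fin n), PrefixOf b y ∧ ∀ δ, F (appendInf b δ) = appendInf c δ

namespace LocallyPrefixReplacing

variable {n : ℕ} {F G : Cantor n → Cantor n}

theorem exists_le_length (hF : LocallyPrefixReplacing F) (y : Cantor n) (m : ℕ) :
    ∃ b c : List (Fin n), m ≤ c.length ∧ PrefixOf b y ∧
      ∀ δ, F (appendInf b δ) = appendInf c δ := by
  obtain ⟨b, c, hb, hbc⟩ := hF y
  obtain ⟨χ, rfl⟩ := prefixOf_iff_exists.1 hb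
  refine ⟨b ++ takeW χ m, c ++ takeW χ m, by simp,
    prefixOf_append_appendInf.2 (prefixOf_takeW χ m), fun δ => ?_⟩
  rw [appendInf_append, hbc, appendInf_append]

theorem appendInf (w : List (Fin n)) : LocallyPrefixReplacing (appendInf w) :=
  fun y => ⟨[], w, prefixOf_nil y, fun δ => by rw [appendInf_nil]⟩

theorem comp (hG : LocallyPrefixReplacing G) (hF : LocallyPrefixReplacing F) :
    LocallyPrefixReplacing (G ∘ F) := by
  intro y
  obtain ⟨b', c', hb', hbc'⟩ := hG (F y)
  obtain ⟨b, c, hlen, hb, hbc⟩ := hF.exists_le_length y b'.length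
  have hc : PrefixOf c (F y) := by
    obtain ⟨χ, rfl⟩ := prefixOf_iff_exists.1 hb
    exact hbc χ ▸ prefixOf_appendInf c χ
  obtain ⟨e, rfl⟩ := hb'.exists_append hc hlen
  refine ⟨b, c' ++ e, hb, fun δ => ?_⟩
  rw [Function.comp_apply, hbc, appendInf_append, hbc', appendInf_append]

/-- Local prefix replacements can be cancelled on the left when they are injective. -/
theorem of_comp (hFG : LocallyPrefixReplacing (F ∘ G)) (hF : LocallyPrefixReplacing F)
    (hinj : Function.Injective F) : LocallyPrefixReplacing G := by
  intro y
  obtain ⟨b', c', hb', hbc'⟩ := hF (G y)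
  obtain ⟨b, c, hlen, hb, hbc⟩ := hFG.exists_le_length y c'.length
  have hc' : PrefixOf c' (F (G y)) := by
    obtain ⟨χ, hχ⟩ := prefixOf_iff_exists.1 hb'
    rw [hχ, hbc']
    exact prefixOf_appendInf c' χ
  have hc : PrefixOf c (F (G y)) := by
    obtain ⟨χ, rfl⟩ := prefixOf_iff_exists.1 hb
    rw [← Function.comp_apply (f := F), hbc]
    exact prefixOf_appendInf c χ
  obtain ⟨e, rfl⟩ := hc'.exists_append hc hlen
  refine ⟨b, b' ++ e, hb, fun δ => hinj ?_⟩
  rw [← Function.comp_apply (f := F), hbc, appendInf_append, appendInf_append, hbc']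

end LocallyPrefixReplacing

namespace Transducer

variable {n : ℕ}

section Contracting

variable {U : Transducer n} {f : Cantor n → Cantor n}

/-- The transducer that outputs nothing until it has read a word `w` of length `j`, at which point
it outputs `v w` and continues as `U` from the state `u w`. -/
def delayed (U : Transducer n) (j : ℕ) (u : List (Fin n) → U.Q)
    (v : List (Fin n) → List (Fin n)) : Transducer n where
  Q := List (Fin n) ⊕ U.Q
  tr := fun x => Sum.elim
    (fun w => if (w ++ [x]).length = j then .inr (u (w ++ [x])) else .inl (w ++ [x]))
    (fun q => .inr (U.tr x q))
  out := fun x => Sum.elim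
    (fun w => if (w ++ [x]).length = j then v (w ++ [x]) else [])
    (fun q => U.out x q)

variable {j : ℕ} {u : List (Fin n) → U.Q} {v : List (Fin n) → List (Fin n)}

theorem delayed_outStar_inr (w : List (Fin n)) (q : U.Q) :
    (U.delayed j u v).outStar w (.inr q) = U.outStar w q := by
  induction w generalizing q with
  | nil => rfl
  | cons x w ih => exact congrArg _ (ih _)

theorem Induces.delayed_inr {q : U.Q} (hf : U.Induces q f) :
    (U.delayed j u v).Induces (.inr q) f := by
  intro χ m
  simpa only [delayed_outStar_inr] using hf χ m

theorem delayed_inl {w : List (Fin n)} (hw : w ≠ []) (w₀ : List (Fin n))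
    (hlen : (w₀ ++ w).length = j) :
    (U.delayed j u v).transStar w (.inl w₀) = .inr (u (w₀ ++ w)) ∧
      (U.delayed j u v).outStar w (.inl w₀) = v (w₀ ++ w) := by
  induction w generalizing w₀ with
  | nil => exact absurd rfl hw
  | cons x w ih =>
    rcases eq_or_ne w [] with rfl | hne
    · simp only [transStar, outStar, delayed, Sum.elim_inl, if_pos hlen, List.append_nil, and_self]
    · have hlt : (w₀ ++ [x]).length ≠ j := by
        have := List.length_pos_iff.2 hne
        simp only [List.length_append, List.length_cons, List.length_nil] at hlen ⊢
        omega
      have happ : w₀ ++ x :: w = (w₀ ++ [x]) ++ w := by simp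
      have htr : (U.delayed j u v).tr x (.inl w₀) = .inl (w₀ ++ [x]) := if_neg hlt
      have hout : (U.delayed j u v).out x (.inl w₀) = [] := if_neg hlt
      rw [happ] at hlen ⊢
      simp only [transStar, outStar, htr, hout, List.nil_append]
      exact ih hne _ hlen

/-- `f` acts on the cone of `w` as a state of `U`, up to adding a prefix to the output. -/
def ActsAsState (U : Transducer n) (f : Cantor n → Cantor n) (w : List (Fin n)) : Prop :=
  ∃ (v : List (Fin n)) (u : U.Q) (g : Cantor n → Cantor n), U.Induces u g ∧
    ∀ χ, f (appendInf w χ) = appendInf v (g χ)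

theorem ActsAsState.append {w : List (Fin n)} (h : U.ActsAsState f w) (d : List (Fin n)) :
    U.ActsAsState f (w ++ d) := by
  obtain ⟨v, u, g, hg, hfg⟩ := h
  obtain ⟨g', hg', hgg'⟩ := hg.exists_transStar d
  refine ⟨v ++ U.outStar d u, _, g', hg', fun χ => ?_⟩
  rw [appendInf_append, hfg, hgg', appendInf_append]

theorem exists_induces_of_actsAsState (hn : 2 ≤ n)
    (h : ∀ x : Cantor n, ∃ k, U.ActsAsState f (takeW x k)) :
    ∃ (V : Transducer n) (p : V.Q), V.Induces p f ∧
      ∃ j : ℕ, ∀ w : List (Fin n), w.length = j →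
        ∃ (u : U.Q) (g : Cantor n → Cantor n),
          V.Induces (V.transStar w p) g ∧ U.Induces u g := by
  obtain ⟨j, hj, hw⟩ := exists_length_forall_of_forall_takeW hn (fun _ d hu => hu.append d) h
  obtain ⟨-, -, q, -⟩ := h fun _ => ⟨0, by omega⟩
  have : Nonempty U.Q := ⟨q⟩
  have : Nonempty (Cantor n → Cantor n) := ⟨id⟩
  choose! v u g hg hfg using hw
  have hV := fun (w : List (Fin n)) (hlen : w.length = j) =>
    delayed_inl (U := U) (u := u) (v := v) (List.ne_nil_of_length_pos (hlen ▸ hj)) [] hlen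
  have hind : ∀ w : List (Fin n), w.length = j →
      (U.delayed j u v).Induces ((U.delayed j u v).transStar w (.inl [])) (g w) :=
    fun w hlen => by
      rw [(hV w hlen).1]
      exact (hg w hlen).delayed_inr
  refine ⟨U.delayed j u v, .inl [], .of_forall_length j fun w hlen =>
    ⟨g w, hind w hlen, fun χ => ?_⟩, j, fun w hlen => ⟨u w, g w, hind w hlen, hg w hlen⟩⟩
  rw [(hV w hlen).2]
  exact hfg w hlen χ

/-- A transducer is contracting if its states lie in a class of maps which is closed under
composition and partial inversion and whose members locally act as states of the transducer. -/
theorem contracting_of_class (hn : 2 ≤ n) (C : (Cantor n → Cantor n) → Prop)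
    (hcomp : ∀ f g, C f → C g → C (g ∘ f))
    (hinv : ∀ f g w, C f → Function.Injective f → (∀ δ, f (g δ) = appendInf w δ) → C g)
    (hU : ∀ q, ∃ f, U.Induces q f ∧ Function.Injective f ∧ C f)
    (hloc : ∀ f, C f → ∀ x : Cantor n, ∃ k, U.ActsAsState f (takeW x k)) : U.Contracting := by
  have hfactor : ∀ (b : Bool) (q : (U.factor b).Q), ∃ f, (U.factor b).Induces q f ∧ C f := by
    have hpartial : ∀ q : U.partialInv.Q, ∃ f, U.partialInv.Induces q f ∧ C f := by
      intro q
      obtain ⟨f, hf, hinj, hC⟩ := hU q.1.2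
      obtain ⟨g, hg, hfg⟩ := exists_induces_restrictTo_invT hn (fun _ hp => hp)
        (fun x p hp => GoodPair.invT_tr hn (fun q => (hU q).imp fun _ h => h.1) hp x) q hf hinj
      exact ⟨g, hg, hinv f g _ hC hinj hfg⟩
    intro b
    cases b with
    | false => exact hpartial
    | true => exact fun q => (hU q).imp fun f hf => ⟨hf.1, hf.2.2⟩
  have hprod : ∀ (L : List Bool), L ≠ [] → ∀ q : (U.prodOf L).Q,
      ∃ f, (U.prodOf L).Induces q f ∧ C f := by
    intro L
    induction L with
    | nil => exact fun h => absurd rfl h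
    | cons b L ih =>
      intro _ q
      cases L with
      | nil => exact hfactor b q
      | cons c L =>
        obtain ⟨f, hf, hCf⟩ := hfactor b q.1
        obtain ⟨g, hg, hCg⟩ := ih (List.cons_ne_nil c L) q.2
        exact ⟨g ∘ f, hf.prod hg, hcomp f g hCf hCg⟩
  intro L hL q
  obtain ⟨f, hf, hC⟩ := hprod L hL q
  obtain ⟨V, p, hV, hj⟩ := exists_induces_of_actsAsState hn (hloc f hC)
  exact ⟨V, p, f, hf, hV, hj⟩

end Contracting

section Synchronizing

variable {T : Transducer n} {q0 : T.Q} {h : Cantor n ≃ₜ Cantor n}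

theorem Accessible.exists_induces (hAcc : T.Accessible q0) (hInd : T.Induces q0 h) (t : T.Q) :
    ∃ f, T.Induces t f ∧ Function.Injective f := by
  obtain ⟨w, rfl⟩ := hAcc t
  obtain ⟨f, hf, hhf⟩ := hInd.exists_transStar w
  refine ⟨f, hf, fun χ χ' hχ => appendInf_injective w (h.injective ?_)⟩
  rw [hhf, hhf, hχ]

/-- In a synchronizing transducer, any state differs from an invertible one by local prefix
replacements. -/
theorem Synchronizing.locallyPrefixReplacing (hSync : T.Synchronizing) (hInd : T.Induces q0 h)
    {t : T.Q} {f : Cantor n → Cantor n} (hf : T.Induces t f) :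
    LocallyPrefixReplacing (f ∘ h.symm) := by
  obtain ⟨k, hk⟩ := hSync
  intro y
  obtain ⟨e, he, hlen⟩ : ∃ e, PrefixOf e (h.symm y) ∧ e.length = k :=
    ⟨_, prefixOf_takeW _ k, takeW_length _ k⟩
  obtain ⟨g, hg, hhg⟩ := hInd.exists_transStar e
  obtain ⟨f', hf', hff'⟩ := hf.exists_transStar e
  rw [hk e hlen t q0] at hf'
  obtain rfl := hf'.unique hg
  have hopen : IsOpen (h.symm ⁻¹' cone e) := (isOpen_cone e).preimage h.symm.continuous
  obtain ⟨m, hm⟩ := exists_cone_takeW_subset hopen he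
  have hout : PrefixOf (T.outStar e q0) y := by
    obtain ⟨χ, hχ⟩ := prefixOf_iff_exists.1 he
    rw [← h.apply_symm_apply y, hχ, hhg]
    exact prefixOf_appendInf _ _
  obtain ⟨d, hd⟩ := hout.exists_append
    (prefixOf_takeW y ((T.outStar e q0).length + m)) (by simp)
  refine ⟨T.outStar e q0 ++ d, T.outStar e t ++ d, hd ▸ prefixOf_takeW y _, fun δ => ?_⟩
  have hmem : appendInf (T.outStar e q0 ++ d) δ ∈ cone (takeW y m) := by
    obtain ⟨d', hd'⟩ := exists_takeW_eq_append y (Nat.le_add_left m (T.outStar e q0).length)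
    rw [← hd, hd']
    exact cone_append_subset _ d' (prefixOf_appendInf _ δ)
  obtain ⟨χ, hχ⟩ := prefixOf_iff_exists.1 (show PrefixOf e _ from hm hmem)
  have hfχ : f' χ = appendInf d δ := by
    rw [h.symm_apply_eq, hhg, appendInf_append] at hχ
    exact (appendInf_injective _ hχ).symm
  rw [Function.comp_apply, hχ, hff', hfχ, appendInf_append]

theorem reach.tr {q : T.Q} (hq : T.reach q0 q) (x : Fin n) : T.reach q0 (T.tr x q) := by
  obtain ⟨w, rfl⟩ := hq
  exact ⟨w ++ [x], T.transStar_append w [x] q0⟩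

theorem goodPair_of_reach (hn : 2 ≤ n) (hAcc : T.Accessible q0) (hInd : T.Induces q0 h)
    (p : List (Fin n) × T.Q) (hp : T.invT.reach ([], q0) p) : T.GoodPair p := by
  obtain ⟨w, rfl⟩ := hp
  refine GoodPair.invT_transStar hn
    (fun t => (hAcc.exists_induces hInd t).imp fun _ hf => hf.1) ?_ w
  refine hInd.goodPair_iff.2 ⟨fun y _ => h.surjective y, fun ρ _ => prefixOf_nil ρ,
    fun l hl => ?_⟩
  obtain ⟨e, he⟩ := exists_append_of_cone_subset hn (u := l) (w := [])
    fun ρ _ => hl ρ (prefixOf_nil _)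
  simp [(List.append_eq_nil_iff.1 he.symm).1]

theorem exists_induces_invAcc (hn : 2 ≤ n) (hAcc : T.Accessible q0) (hInd : T.Induces q0 h)
    (p : (T.invAcc q0).Q) : ∃ f g, T.Induces p.1.2 f ∧ Function.Injective f ∧
      (T.invAcc q0).Induces p g ∧ ∀ δ, f (g δ) = appendInf p.1.1 δ := by
  obtain ⟨f, hf, hinj⟩ := hAcc.exists_induces hInd p.1.2
  obtain ⟨g, hg, hfg⟩ := exists_induces_restrictTo_invT hn (goodPair_of_reach hn hAcc hInd)
    (fun x p hp => reach.tr hp x) p hf hinj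
  exact ⟨f, g, hf, hinj, hg, hfg⟩

theorem induces_invAcc_symm (hn : 2 ≤ n) (hAcc : T.Accessible q0) (hInd : T.Induces q0 h) :
    (T.invAcc q0).Induces ⟨([], q0), [], rfl⟩ h.symm := by
  obtain ⟨f, g, hf, -, hg, hfg⟩ := exists_induces_invAcc hn hAcc hInd ⟨([], q0), [], rfl⟩
  obtain rfl := hf.unique hInd
  convert hg using 1
  funext δ
  rw [h.symm_apply_eq, hfg, appendInf_nil]

theorem exists_induces_invAcc_locallyPrefixReplacing (hn : 2 ≤ n) (hAcc : T.Accessible q0)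
    (hInd : T.Induces q0 h) (hSync : T.Synchronizing) (p : (T.invAcc q0).Q) :
    ∃ g, (T.invAcc q0).Induces p g ∧ Function.Injective g ∧ LocallyPrefixReplacing (h ∘ g) := by
  obtain ⟨f, g, hf, hinj, hg, hfg⟩ := exists_induces_invAcc hn hAcc hInd p
  refine ⟨g, hg, fun δ δ' hδ => appendInf_injective p.1.1 ?_, ?_⟩
  · rw [← hfg, ← hfg, hδ]
  · refine .of_comp (F := f ∘ h.symm) ?_ (hSync.locallyPrefixReplacing hInd hf)
      (hinj.comp h.symm.injective)
    convert LocallyPrefixReplacing.appendInf p.1.1 using 1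
    funext δ
    simp [hfg]

theorem prod_invAcc_contracting (hn : 2 ≤ n) (hAcc : T.Accessible q0) (hInd : T.Induces q0 h)
    (hSync : T.Synchronizing) : (T.prod (T.invAcc q0)).Contracting := by
  refine contracting_of_class hn (fun f => LocallyPrefixReplacing (h ∘ f ∘ h.symm)) ?_ ?_ ?_ ?_
  · intro f g hf hg
    convert hg.comp hf using 1
    funext y
    simp
  · intro f g w hf hinj hfg
    refine .of_comp (F := h ∘ f ∘ h.symm) ?_ hf
      (h.injective.comp (hinj.comp h.symm.injective))
    obtain ⟨f', hf', hhf'⟩ := hInd.exists_transStar w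
    convert (LocallyPrefixReplacing.appendInf (T.outStar w q0)).comp
      (hSync.locallyPrefixReplacing hInd hf') using 1
    funext y
    simp [hfg, hhf']
  · rintro ⟨t, p⟩
    obtain ⟨f, hf, hinj⟩ := hAcc.exists_induces hInd t
    obtain ⟨g, hg, hginj, hlg⟩ := exists_induces_invAcc_locallyPrefixReplacing hn hAcc hInd hSync p
    exact ⟨g ∘ f, hf.prod hg, hginj.comp hinj,
      hlg.comp (hSync.locallyPrefixReplacing hInd hf)⟩
  · intro f hf x
    obtain ⟨b, c, hb, hbc⟩ := hf (h x)
    obtain ⟨k, hk, hpre⟩ := hInd x b.length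
    obtain ⟨e, he⟩ := hb.exists_append hpre hk
    obtain ⟨g, hg, hhg⟩ := hInd.exists_transStar (takeW x k)
    obtain ⟨s, hs, hhs⟩ := (induces_invAcc_symm hn hAcc hInd).exists_transStar (c ++ e)
    refine ⟨k, (T.invAcc q0).outStar (c ++ e) ⟨([], q0), [], rfl⟩, _, s ∘ g, hg.prod hs,
      fun χ => ?_⟩
    rw [Function.comp_apply, ← hhs, appendInf_append, ← hbc, ← appendInf_append, ← he, ← hhg]
    simp

theorem invAcc_prod_contracting (hn : 2 ≤ n) (hAcc : T.Accessible q0) (hInd : T.Induces q0 h)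
    (hSync : T.Synchronizing) : ((T.invAcc q0).prod T).Contracting := by
  refine contracting_of_class hn LocallyPrefixReplacing (fun f g hf hg => hg.comp hf) ?_ ?_ ?_
  · intro f g w hf hinj hfg
    refine .of_comp (F := f) ?_ hf hinj
    convert LocallyPrefixReplacing.appendInf w using 1
    exact funext hfg
  · rintro ⟨p, t⟩
    obtain ⟨f, hf, hinj⟩ := hAcc.exists_induces hInd t
    obtain ⟨g, hg, hginj, hlg⟩ := exists_induces_invAcc_locallyPrefixReplacing hn hAcc hInd hSync p
    refine ⟨f ∘ g, hg.prod hf, hinj.comp hginj, ?_⟩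
    convert (hSync.locallyPrefixReplacing hInd hf).comp hlg using 1
    funext y
    simp
  · intro f hf x
    obtain ⟨b, c, hb, hbc⟩ := hf x
    refine ⟨b.length, c, _, _, (induces_invAcc_symm hn hAcc hInd).prod hInd, fun χ => ?_⟩
    rw [hb.takeW_eq, hbc, Function.comp_apply, h.apply_symm_apply]

end Synchronizing

end Transducer

/-- Proposition 6.14. Let `T_{q0}` be an initial, synchronizing,
invertible transducer without states of incomplete response, with inverse
`S = S_{(ε,q0)}`.  Then the product transducers `TS` and `ST` are both contracting. -/
theorem TS_and_ST_contracting_of_synchronizing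
    {n : ℕ} (hn : 2 ≤ n) (T : Transducer n) [Finite T.Q] (q0 : T.Q)
    (h : Cantor n ≃ₜ Cantor n) (hInd : T.Induces q0 ⇑h)
    (hNIR : T.NoIncompleteResponse) (hSync : T.Synchronizing)
    (hAcc : T.Accessible q0) :
    (T.prod (T.invAcc q0)).Contracting ∧ ((T.invAcc q0).prod T).Contracting := by
  exact ⟨Transducer.prod_invAcc_contracting hn hAcc hInd hSync,
    Transducer.invAcc_prod_contracting hn hAcc hInd hSync⟩
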